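/- Assume h'' ≥ 0 and f'·h' ≥ 0 on [0,∞) (so that f ≥ 1 is non-decreasing and h' ≥ 1 is non-decreasing). Let r : [a,b] → (0, r₂] be C² with r'(a) = r'(b) = 0 and area A(r) ≤ A₀, and suppose that for some 0 < r₃ ≤ r₂ the Lebesgue measure of {z ∈ [a,b] : r(z) ≥ r₃} is at least ρ₃ > 0. Then the averaged mean curvature satisfies the positive lower bound H̄(r) ≥ (σ·ρ₃/A₀)·(n−1)·h'(r₃)·h(r₃)^{n−2} > 0. -/

import Mathlib

open Real Set MeasureTheory Filter

/-- β(s) = ∫₀^s f(ρ) h(ρ)^{n−1} dρ -/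
noncomputable def sBeta (n : ℕ) (f h : ℝ → ℝ) (s : ℝ) : ℝ :=
  ∫ ρ in (0:ℝ)..s, f ρ * h ρ ^ (n - 1)

/-- δ(s) = ∫₀^s h(ρ)^{n−1} dρ -/
noncomputable def sDelta (n : ℕ) (h : ℝ → ℝ) (s : ℝ) : ℝ :=
  ∫ ρ in (0:ℝ)..s, h ρ ^ (n - 1)

/-- The n-volume (area) of the revolution hypersurface generated by the graph of r. -/
noncomputable def area (n : ℕ) (f h : ℝ → ℝ) (σ a b : ℝ) (r : ℝ → ℝ) : ℝ :=
  σ * ∫ z in a..b, Real.sqrt ((deriv r z) ^ 2 + (f (r z)) ^ 2) * h (r z) ^ (n - 1)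

/-- The (n+1)-volume enclosed by the revolution hypersurface generated by the graph of r. -/
noncomputable def encVol (n : ℕ) (f h : ℝ → ℝ) (σ a b : ℝ) (r : ℝ → ℝ) : ℝ :=
  σ * ∫ z in a..b, sBeta n f h (r z)

/-- The averaged mean curvature H̄ of the revolution hypersurface generated by the graph of r. -/
noncomputable def avgH (n : ℕ) (f h : ℝ → ℝ) (σ a b : ℝ) (r : ℝ → ℝ) : ℝ :=
  (σ / area n f h σ a b r) *
    ∫ z in a..b,
      (-(deriv (fun w => Real.arctan (deriv r w / f (r w))) z)
        + (((n : ℝ) - 1) * deriv h (r z) * f (r z) + deriv f (r z) * h (r z)) / h (r z))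
        * h (r z) ^ (n - 1)

/-- A function that is nonnegative on `[a, b]` and at least `c` on a measurable subset has integral
at least `c` times the measure of that subset. -/
theorem mul_measureReal_le_intervalIntegral {a b c : ℝ} (hab : a ≤ b) {G : ℝ → ℝ} {S : Set ℝ}
    (hS : MeasurableSet S) (hSI : S ⊆ Icc a b) (hG : ContinuousOn G (Icc a b))
    (hG0 : ∀ z ∈ Icc a b, 0 ≤ G z) (hGc : ∀ z ∈ S, c ≤ G z) :
    c * (volume S).toReal ≤ ∫ z in a..b, G z := by
  have hint : IntegrableOn G (Icc a b) := hG.integrableOn_Icc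
  have hSfin : volume S ≠ ⊤ := ((measure_mono hSI).trans_lt measure_Icc_lt_top).ne
  rw [intervalIntegral.integral_of_le hab, ← integral_Icc_eq_integral_Ioc]
  calc c * (volume S).toReal ≤ ∫ z in S, G z :=
        setIntegral_ge_of_const_le_real hS hSfin hGc (hint.mono_set hSI)
    _ ≤ ∫ z in Icc a b, G z :=
        setIntegral_mono_set hint
          ((ae_restrict_iff' measurableSet_Icc).2 (Eventually.of_forall hG0))
          (LE.le.eventuallyLE hSI)

/-- A continuously differentiable function vanishing at both endpoints, whose product with `g'` is
nonnegative, satisfies `∫ φ' g ≤ 0`. -/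
theorem intervalIntegral_deriv_mul_nonpos {a b : ℝ} (hab : a ≤ b) {φ φ' g g' : ℝ → ℝ}
    (hφ : ∀ z ∈ Icc a b, HasDerivAt φ (φ' z) z) (hg : ∀ z ∈ Icc a b, HasDerivAt g (g' z) z)
    (hφ' : ContinuousOn φ' (Icc a b)) (hg' : ContinuousOn g' (Icc a b))
    (ha : φ a = 0) (hb : φ b = 0) (hnonneg : ∀ z ∈ Icc a b, 0 ≤ φ z * g' z) :
    ∫ z in a..b, φ' z * g z ≤ 0 := by
  have hparts := intervalIntegral.integral_mul_deriv_eq_deriv_mul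
    (by rwa [uIcc_of_le hab]) (by rwa [uIcc_of_le hab])
    (hφ'.intervalIntegrable_of_Icc hab) (hg'.intervalIntegrable_of_Icc hab)
  have h0 := intervalIntegral.integral_nonneg (μ := volume) hab hnonneg
  rw [hparts, ha, hb] at h0
  linarith

theorem monotoneOn_Ici_of_deriv_nonneg {g : ℝ → ℝ} (hg : Differentiable ℝ g)
    (hg' : ∀ s : ℝ, 0 ≤ s → 0 ≤ deriv g s) : MonotoneOn g (Ici 0) :=
  monotoneOn_of_deriv_nonneg (convex_Ici 0) hg.continuous.continuousOn hg.differentiableOn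
    fun s hs => hg' s (interior_subset hs)

theorem arctan_div_mul_nonneg {x y : ℝ} (hy : 0 < y) : 0 ≤ arctan (x / y) * x := by
  rcases le_total 0 x with hx | hx
  · exact mul_nonneg (arctan_nonneg.2 (div_nonneg hx hy.le)) hx
  · exact mul_nonneg_of_nonpos_of_nonpos
      (arctan_le_zero.2 (div_nonpos_of_nonpos_of_nonneg hx hy.le)) hx

/-- Finer positive lower bound for the averaged mean curvature: if r ≥ r₃ on a set of
measure at least ρ₃ and A(r) ≤ A₀, then H̄(r) ≥ (σρ₃/A₀)(n−1)h'(r₃)h(r₃)^{n−2} > 0. -/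
theorem stmt_15 (n : ℕ) (hn : 2 ≤ n) (f h : ℝ → ℝ)
    (hf : ContDiff ℝ (⊤ : ℕ∞) f) (hh : ContDiff ℝ (⊤ : ℕ∞) h)
    (hfpos : ∀ s : ℝ, 0 ≤ s → 0 < f s) (hhpos : ∀ s : ℝ, 0 < s → 0 < h s)
    (hf0 : f 0 = 1) (hf'0 : deriv f 0 = 0) (hh0 : h 0 = 0) (hh'0 : deriv h 0 = 1)
    (σ : ℝ) (hσ : 0 < σ) (a b : ℝ) (hab : a < b)
    (hSri : ∀ s : ℝ, 0 ≤ s → 0 ≤ deriv (deriv h) s)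
    (hSzi : ∀ s : ℝ, 0 ≤ s → 0 ≤ deriv f s * deriv h s)
    (r₂ A₀ r₃ ρ₃ : ℝ) (hr₂ : 0 < r₂) (hA₀ : 0 < A₀)
    (hr₃pos : 0 < r₃) (hr₃r₂ : r₃ ≤ r₂) (hρ₃ : 0 < ρ₃)
    (r : ℝ → ℝ) (hr : ContDiff ℝ 2 r)
    (hrange : ∀ z ∈ Set.Icc a b, r z ∈ Set.Ioc 0 r₂)
    (hra : deriv r a = 0) (hrb : deriv r b = 0)
    (harea : area n f h σ a b r ≤ A₀)
    (hmeas : ρ₃ ≤ (volume {z ∈ Set.Icc a b | r₃ ≤ r z}).toReal) :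
    (σ * ρ₃ / A₀) * ((n : ℝ) - 1) * deriv h r₃ * h r₃ ^ (n - 2) ≤ avgH n f h σ a b r
    ∧ 0 < (σ * ρ₃ / A₀) * ((n : ℝ) - 1) * deriv h r₃ * h r₃ ^ (n - 2) := by
  have hn1 : (0 : ℝ) < (n : ℝ) - 1 := by
    have : (2 : ℝ) ≤ n := by exact_mod_cast hn
    linarith
  have hfd : Differentiable ℝ f := hf.differentiable (by simp)
  have hhd : Differentiable ℝ h := hh.differentiable (by simp)
  have hf'c : Continuous (deriv f) := hf.continuous_deriv (by simp)
  have hh'cd : ContDiff ℝ 1 (deriv h) :=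
    ContDiff.deriv' (n := 1) (contDiff_infty.1 hh 2)
  have hr'cd : ContDiff ℝ 1 (deriv r) :=
    ContDiff.deriv' (n := 1) (by simpa [one_add_one_eq_two] using hr)
  have hrd : Differentiable ℝ r := hr.differentiable (by simp)
  have hh'mono : MonotoneOn (deriv h) (Ici 0) :=
    monotoneOn_Ici_of_deriv_nonneg (hh'cd.differentiable (by simp)) hSri
  have hh'one : ∀ s : ℝ, 0 ≤ s → 1 ≤ deriv h s := fun s hs =>
    hh'0 ▸ hh'mono self_mem_Ici hs hs
  have hhmono : MonotoneOn h (Ici 0) :=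
    monotoneOn_Ici_of_deriv_nonneg hhd fun s hs => zero_le_one.trans (hh'one s hs)
  have hf'nonneg : ∀ s : ℝ, 0 ≤ s → 0 ≤ deriv f s := fun s hs =>
    nonneg_of_mul_nonneg_left (hSzi s hs) (zero_lt_one.trans_le (hh'one s hs))
  have hfone : ∀ s : ℝ, 0 ≤ s → 1 ≤ f s := fun s hs =>
    hf0 ▸ monotoneOn_Ici_of_deriv_nonneg hfd hf'nonneg self_mem_Ici hs hs
  have hrpos : ∀ z ∈ Icc a b, 0 < r z := fun z hz => (hrange z hz).1
  have hApos : 0 < area n f h σ a b r := by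
    refine mul_pos hσ (intervalIntegral.intervalIntegral_pos_of_pos_on ?_ ?_ hab)
    · exact Continuous.intervalIntegrable (((hr'cd.continuous.pow 2).add
        ((hfd.continuous.comp hrd.continuous).pow 2)).sqrt.mul
        ((hhd.continuous.comp hrd.continuous).pow _)) _ _
    · intro z hz
      have hz' := hrpos z (Ioo_subset_Icc_self hz)
      have := hfpos _ hz'.le
      have := hhpos _ hz'
      positivity
  set c : ℝ := ((n : ℝ) - 1) * deriv h r₃ * h r₃ ^ (n - 2) with hc
  have hcpos : 0 < c :=
    mul_pos (mul_pos hn1 (zero_lt_one.trans_le (hh'one _ hr₃pos.le))) (pow_pos (hhpos _ hr₃pos) _)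
  set φ : ℝ → ℝ := fun w => arctan (deriv r w / f (r w)) with hφ
  have hopen : IsOpen {z | f (r z) ≠ 0} :=
    isOpen_ne_fun (hfd.continuous.comp hrd.continuous) continuous_const
  have hsub : Icc a b ⊆ {z | f (r z) ≠ 0} := fun z hz => (hfpos _ (hrpos z hz).le).ne'
  have hφcd : ContDiffOn ℝ 1 φ {z | f (r z) ≠ 0} := by
    refine contDiff_arctan.comp_contDiffOn (hr'cd.contDiffOn.div ?_ fun z hz => hz)
    exact ((contDiff_infty.1 hf 1).comp (hr.of_le one_le_two)).contDiffOn
  have hφd : ∀ z ∈ Icc a b, HasDerivAt φ (deriv φ z) z := fun z hz =>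
    ((hφcd.differentiableOn (by simp)).differentiableAt (hopen.mem_nhds (hsub hz))).hasDerivAt
  have hφ'c : ContinuousOn (deriv φ) (Icc a b) :=
    (hφcd.continuousOn_deriv_of_isOpen hopen le_rfl).mono hsub
  have hgd : ∀ z ∈ Icc a b, HasDerivAt (fun z => h (r z) ^ (n - 1))
      (((n - 1 : ℕ) : ℝ) * h (r z) ^ (n - 1 - 1) * (deriv h (r z) * deriv r z)) z := fun z _ =>
    (((hhd _).hasDerivAt).comp z (hrd z).hasDerivAt).pow _
  have hcurv : ∫ z in a..b, deriv φ z * h (r z) ^ (n - 1) ≤ 0 := by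
    refine intervalIntegral_deriv_mul_nonpos hab.le hφd hgd hφ'c ?_ (by simp [hφ, hra])
      (by simp [hφ, hrb]) fun z hz => ?_
    · exact ((continuous_const.mul ((hhd.continuous.comp hrd.continuous).pow _)).mul
        ((hh'cd.continuous.comp hrd.continuous).mul hr'cd.continuous)).continuousOn
    · have hz' := hrpos z hz
      have hker : 0 ≤ φ z * deriv r z := arctan_div_mul_nonneg (hfpos _ hz'.le)
      have hh'z : 0 ≤ deriv h (r z) := zero_le_one.trans (hh'one _ hz'.le)
      have hhz := hhpos _ hz'
      calc 0 ≤ (((n - 1 : ℕ) : ℝ) * h (r z) ^ (n - 1 - 1) * deriv h (r z)) *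
            (φ z * deriv r z) := by positivity
        _ = _ := by ring
  set G : ℝ → ℝ := fun z => ((n : ℝ) - 1) * deriv h (r z) * h (r z) ^ (n - 2) * f (r z) +
    deriv f (r z) * h (r z) ^ (n - 1) with hG
  have hGc : Continuous G := by
    have := hfd.continuous.comp hrd.continuous
    have := hhd.continuous.comp hrd.continuous
    have := hf'c.comp hrd.continuous
    have := hh'cd.continuous.comp hrd.continuous
    simp only [Function.comp_def] at *
    fun_prop
  have hGlow : ∀ z ∈ Icc a b,
      ((n : ℝ) - 1) * deriv h (r z) * h (r z) ^ (n - 2) ≤ G z := fun z hz => by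
    have hz' := hrpos z hz
    have hh'z : 0 ≤ deriv h (r z) := zero_le_one.trans (hh'one _ hz'.le)
    have hhz := hhpos _ hz'
    have hf'z := hf'nonneg _ hz'.le
    exact (le_mul_of_one_le_right (by positivity) (hfone _ hz'.le)).trans
      (le_add_of_nonneg_right (by positivity))
  have hGint : c * ρ₃ ≤ ∫ z in a..b, G z := by
    refine (mul_le_mul_of_nonneg_left hmeas hcpos.le).trans
      (mul_measureReal_le_intervalIntegral hab.le ?_ (sep_subset _ _) hGc.continuousOn ?_ ?_)
    · exact measurableSet_Icc.inter (measurableSet_le measurable_const hrd.continuous.measurable)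
    · intro z hz
      have hz' := hrpos z hz
      have hh'z : 0 ≤ deriv h (r z) := zero_le_one.trans (hh'one _ hz'.le)
      have hhz := hhpos _ hz'
      exact le_trans (by positivity) (hGlow z hz)
    · rintro z ⟨hz, hrz⟩
      refine le_trans ?_ (hGlow z hz)
      have hz' := (hrpos z hz).le
      have hh₃ := hhpos _ hr₃pos
      have hh'z : 0 ≤ deriv h (r z) := zero_le_one.trans (hh'one _ hz')
      have h1 := hh'mono (mem_Ici.2 hr₃pos.le) (mem_Ici.2 hz') hrz
      have h2 := hhmono (mem_Ici.2 hr₃pos.le) (mem_Ici.2 hz') hrz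
      rw [hc]
      gcongr
  have hsplit : ∫ z in a..b, (-(deriv φ z) + (((n : ℝ) - 1) * deriv h (r z) * f (r z) +
      deriv f (r z) * h (r z)) / h (r z)) * h (r z) ^ (n - 1) =
      (∫ z in a..b, G z) - ∫ z in a..b, deriv φ z * h (r z) ^ (n - 1) := by
    have hφg : IntervalIntegrable (fun z => deriv φ z * h (r z) ^ (n - 1)) volume a b :=
      (hφ'c.mul ((hhd.continuous.comp hrd.continuous).pow
        (n - 1)).continuousOn).intervalIntegrable_of_Icc hab.le
    rw [← intervalIntegral.integral_sub (hGc.intervalIntegrable _ _) hφg]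
    refine intervalIntegral.integral_congr fun z hz => ?_
    rw [uIcc_of_le hab.le] at hz
    have hhz := (hhpos _ (hrpos z hz)).ne'
    obtain ⟨k, rfl⟩ := Nat.exists_eq_add_of_le' hn
    simp only [hG, Nat.add_sub_cancel, show k + 2 - 1 = k + 1 from rfl]
    field_simp
    ring
  have hlhs : σ * ρ₃ / A₀ * ((n : ℝ) - 1) * deriv h r₃ * h r₃ ^ (n - 2) =
      σ / A₀ * (c * ρ₃) := by
    rw [hc]; ring
  rw [hlhs]
  refine ⟨?_, by positivity⟩
  rw [avgH, hsplit]
  have hI : c * ρ₃ ≤ (∫ z in a..b, G z) - ∫ z in a..b, deriv φ z * h (r z) ^ (n - 1) := by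
    linarith
  gcongr
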